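/- Let P ⊆ ℝⁿ be a bounded convex set of positive Lebesgue measure. Then the Lebesgue measure of S_P equals the Lebesgue measure of P. -/

import Mathlib

open MvPolynomial

/-- A monomial order on ℕⁿ: a linear order (total, antisymmetric, transitive)
that is a well-order and is compatible with addition. -/
def IsMonomialOrder (n : ℕ) (r : (Fin n → ℕ) → (Fin n → ℕ) → Prop) : Prop :=
  (∀ a b, r a b ∨ r b a) ∧
  (∀ a b, r a b → r b a → a = b) ∧
  (∀ a b c, r a b → r b c → r a c) ∧
  WellFounded (fun a b => r a b ∧ a ≠ b) ∧
  (∀ a b c, r a b → r (a + c) (b + c))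

/-- `e` is the exponent of the leading monomial of `p` w.r.t. the monomial order `r`. -/
def IsLeadMon {n : ℕ} (r : (Fin n → ℕ) → (Fin n → ℕ) → Prop)
    (p : MvPolynomial (Fin n) ℝ) (e : Fin n → ℕ) : Prop :=
  (∃ d ∈ p.support, ⇑d = e) ∧ ∀ d ∈ p.support, r (⇑d) e

/-- `E_A`: the set of exponents `e` such that no (nonzero) polynomial vanishing on `A`
has leading monomial `X^e`. -/
def ESet {n : ℕ} (r : (Fin n → ℕ) → (Fin n → ℕ) → Prop)
    (A : Set (Fin n → ℝ)) : Set (Fin n → ℕ) :=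
  {e | ¬ ∃ p : MvPolynomial (Fin n) ℝ, (∀ a ∈ A, eval a p = 0) ∧ IsLeadMon r p e}

open Pointwise MeasureTheory

/-- The lattice `ℤⁿ` viewed as a subset of `ℝⁿ`. -/
def latticePoints (n : ℕ) : Set (Fin n → ℝ) := {x | ∀ i, ∃ m : ℤ, x i = (m : ℝ)}

/-- `S_P`: the closure of the increasing union `⋃ₖ 2⁻ᵏ·E_{2ᵏ·P ∩ ℤⁿ}`,
viewing each `E_{2ᵏ·P ∩ ℤⁿ} ⊆ ℕⁿ` as a subset of `ℝⁿ`. -/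
noncomputable def SP {n : ℕ} (r : (Fin n → ℕ) → (Fin n → ℕ) → Prop)
    (P : Set (Fin n → ℝ)) : Set (Fin n → ℝ) :=
  closure (⋃ k : ℕ,
    (fun (e : Fin n → ℕ) (i : Fin n) => (e i : ℝ) / 2 ^ k) ''
      ESet r (((2 ^ k : ℝ) • P) ∩ latticePoints n))


namespace IsMonomialOrder

variable {n : ℕ} {r : (Fin n → ℕ) → (Fin n → ℕ) → Prop}

lemma refl (hr : IsMonomialOrder n r) (a : Fin n → ℕ) : r a a := (hr.1 a a).elim id id

lemma antisymm (hr : IsMonomialOrder n r) {a b : Fin n → ℕ} (h : r a b) (h' : r b a) : a = b :=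
  hr.2.1 a b h h'

lemma trans (hr : IsMonomialOrder n r) {a b c : Fin n → ℕ} (h : r a b) (h' : r b c) : r a c :=
  hr.2.2.1 a b c h h'

lemma wf (hr : IsMonomialOrder n r) : WellFounded (fun a b => r a b ∧ a ≠ b) := hr.2.2.2.1

lemma add_right (hr : IsMonomialOrder n r) {a b : Fin n → ℕ} (h : r a b) (c : Fin n → ℕ) :
    r (a + c) (b + c) := hr.2.2.2.2 a b c h

lemma add_left (hr : IsMonomialOrder n r) {a b : Fin n → ℕ} (h : r a b) (c : Fin n → ℕ) :
    r (c + a) (c + b) := by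
  rw [add_comm c a, add_comm c b]
  exact hr.add_right h c

lemma add (hr : IsMonomialOrder n r) {a b c d : Fin n → ℕ} (h : r a b) (h' : r c d) :
    r (a + c) (b + d) :=
  hr.trans (hr.add_right h c) (hr.add_left h' b)

/-- If a sum of two terms, each bounded on the same side, attains the bound, so do the terms. -/
lemma eq_and_eq_of_add_eq (hr : IsMonomialOrder n r) {a b c d : Fin n → ℕ} (h : r a b)
    (h' : r c d) (heq : r (b + d) (a + c)) : a = b ∧ c = d := by
  constructor
  · have h1 : r (a + d) (b + d) := hr.add_right h d
    have h2 : r (b + d) (a + d) := hr.trans heq (hr.add_left h' a)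
    exact add_right_cancel (hr.antisymm h1 h2)
  · have h1 : r (b + c) (b + d) := hr.add_left h' b
    have h2 : r (b + d) (b + c) := hr.trans heq (hr.add_right h c)
    exact add_left_cancel (hr.antisymm h1 h2)

lemma zero_le (hr : IsMonomialOrder n r) (a : Fin n → ℕ) : r 0 a := by
  obtain ⟨m, -, hm⟩ := hr.wf.has_min Set.univ ⟨0, trivial⟩
  have hmin : ∀ x, r m x := fun x => by
    by_contra h
    have hx : r x m := (hr.1 m x).resolve_left h
    exact hm x trivial ⟨hx, fun e => h (e ▸ hx)⟩
  have hm0 : m = 0 := by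
    have h1 : r (m + m) (0 + m) := hr.add_right (hmin 0) m
    rw [zero_add] at h1
    simpa using hr.antisymm h1 (hmin _)
  exact hm0 ▸ hmin a

lemma exists_max (hr : IsMonomialOrder n r) {ι : Type*} (s : Finset ι) (hs : s.Nonempty)
    (f : ι → Fin n → ℕ) : ∃ a ∈ s, ∀ b ∈ s, r (f b) (f a) := by
  induction hs using Finset.Nonempty.cons_induction with
  | singleton a => exact ⟨a, by simp, by simpa using hr.refl _⟩
  | cons a s ha hs ih =>
    obtain ⟨m, hm, hmax⟩ := ih
    rcases hr.1 (f a) (f m) with h | h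
    · refine ⟨m, by simp [hm], fun b hb => ?_⟩
      rcases Finset.mem_cons.1 hb with rfl | hb
      · exact h
      · exact hmax b hb
    · refine ⟨a, by simp, fun b hb => ?_⟩
      rcases Finset.mem_cons.1 hb with rfl | hb
      · exact hr.refl _
      · exact hr.trans (hmax b hb) h

end IsMonomialOrder

section Polynomial

variable {n : ℕ} {r : (Fin n → ℕ) → (Fin n → ℕ) → Prop}

lemma isLeadMon_coe_iff {p : MvPolynomial (Fin n) ℝ} {e : Fin n →₀ ℕ} :
    IsLeadMon r p ⇑e ↔ e ∈ p.support ∧ ∀ d ∈ p.support, r ⇑d ⇑e := by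
  refine and_congr_left fun _ => ⟨?_, fun h => ⟨e, h, rfl⟩⟩
  rintro ⟨d, hd, hde⟩
  rwa [← DFunLike.coe_injective hde]

lemma IsMonomialOrder.exists_isLeadMon (hr : IsMonomialOrder n r) {p : MvPolynomial (Fin n) ℝ}
    (hp : p ≠ 0) : ∃ e ∈ p.support, IsLeadMon r p ⇑e := by
  obtain ⟨e, he, hmax⟩ := hr.exists_max p.support
    (Finset.nonempty_iff_ne_empty.2 (by simpa using hp)) (fun d => ⇑d)
  exact ⟨e, he, isLeadMon_coe_iff.2 ⟨he, hmax⟩⟩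

lemma IsLeadMon.mul (hr : IsMonomialOrder n r) {p q : MvPolynomial (Fin n) ℝ}
    {e f : Fin n →₀ ℕ} (hp : IsLeadMon r p ⇑e) (hq : IsLeadMon r q ⇑f) :
    IsLeadMon r (p * q) ⇑(e + f) := by
  classical
  rw [isLeadMon_coe_iff] at hp hq ⊢
  refine ⟨?_, fun d hd => ?_⟩
  · rw [mem_support_iff, coeff_mul, Finset.sum_eq_single (e, f)]
    · exact mul_ne_zero (mem_support_iff.1 hp.1) (mem_support_iff.1 hq.1)
    · rintro ⟨c, d⟩ hcd hne
      by_contra h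
      obtain ⟨hc, hd⟩ := mul_ne_zero_iff.1 h
      have hsum : c + d = e + f := Finset.HasAntidiagonal.mem_antidiagonal.1 hcd
      have := hr.eq_and_eq_of_add_eq (hp.2 c (mem_support_iff.2 hc)) (hq.2 d (mem_support_iff.2 hd))
        (by rw [← Finsupp.coe_add, ← Finsupp.coe_add, hsum]; exact hr.refl _)
      exact hne (Prod.ext (DFunLike.coe_injective this.1) (DFunLike.coe_injective this.2))
    · simp
  · obtain ⟨c, hc, d', hd', rfl⟩ := Finset.mem_add.1 (support_mul p q hd)
    exact hr.add (hp.2 c hc) (hq.2 d' hd')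

lemma IsMonomialOrder.isLeadMon_monomial (hr : IsMonomialOrder n r) (e : Fin n →₀ ℕ) :
    IsLeadMon r (monomial e (1 : ℝ)) ⇑e := by
  rw [isLeadMon_coe_iff]
  simpa [support_monomial] using hr.refl _

lemma IsMonomialOrder.isLeadMon_X_sub_C (hr : IsMonomialOrder n r) (i : Fin n) (c : ℝ) :
    IsLeadMon r (X i - C c) ⇑(Finsupp.single i 1) := by
  classical
  have hi : (0 : Fin n →₀ ℕ) ≠ Finsupp.single i 1 := (Finsupp.single_ne_zero.2 one_ne_zero).symm
  rw [isLeadMon_coe_iff]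
  refine ⟨by simp [coeff_C, hi], fun d hd => ?_⟩
  by_cases h0 : d = 0
  · subst h0; exact hr.zero_le _
  · have : d = Finsupp.single i 1 := by
      by_contra h
      simp [coeff_C, Ne.symm h0, coeff_X, Ne.symm h] at hd
    exact this ▸ hr.refl _

lemma IsMonomialOrder.isLeadMon_prod_X_sub_C (hr : IsMonomialOrder n r) (i : Fin n)
    (s : Finset ℝ) :
    IsLeadMon r (∏ c ∈ s, (X i - C c)) ⇑(Finsupp.single i s.card) := by
  classical
  induction s using Finset.induction_on with
  | empty => simpa using hr.isLeadMon_monomial 0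
  | insert a s ha ih =>
    rw [Finset.prod_insert ha, Finset.card_insert_of_notMem ha, add_comm, Finsupp.single_add]
    exact IsLeadMon.mul hr (hr.isLeadMon_X_sub_C i a) ih

lemma ESet_mono {A B : Set (Fin n → ℝ)} (h : A ⊆ B) : ESet r A ⊆ ESet r B :=
  fun _ he ⟨p, hp, hl⟩ => he ⟨p, fun a ha => hp a (h ha), hl⟩

lemma isLowerSet_ESet (hr : IsMonomialOrder n r) (A : Set (Fin n → ℝ)) :
    IsLowerSet (ESet r A) := by
  rintro e f hfe he ⟨p, hp, hl⟩
  refine he ⟨monomial (Finsupp.equivFunOnFinite.symm (e - f)) 1 * p,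
    fun a ha => by simp [hp a ha], ?_⟩
  have := IsLeadMon.mul hr (hr.isLeadMon_monomial (Finsupp.equivFunOnFinite.symm (e - f)))
    (f := Finsupp.equivFunOnFinite.symm f) (q := p) (by simpa using hl)
  simpa [tsub_add_cancel_of_le hfe] using this

/-- Exponents in `ESet r A` are bounded by the number of coordinate values occurring in `A`. -/
lemma apply_lt_card_of_mem_ESet (hr : IsMonomialOrder n r) {A : Set (Fin n → ℝ)} {i : Fin n}
    {s : Finset ℝ} (hs : ∀ a ∈ A, a i ∈ s) {e : Fin n → ℕ} (he : e ∈ ESet r A) :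
    e i < s.card := by
  classical
  by_contra! h
  have hle : ⇑(Finsupp.single i s.card) ≤ e := fun j => by
    rw [Finsupp.single_apply]
    split_ifs with hj
    · exact hj ▸ h
    · exact Nat.zero_le _
  refine isLowerSet_ESet hr A hle he ⟨_, fun a ha => ?_, hr.isLeadMon_prod_X_sub_C i s⟩
  rw [map_prod]
  exact Finset.prod_eq_zero (hs a ha) (by simp)

/-- Evaluation of polynomials at the points of `A`. -/
noncomputable def evalOn (A : Set (Fin n → ℝ)) : MvPolynomial (Fin n) ℝ →ₗ[ℝ] (A → ℝ) :=
  LinearMap.pi fun a => (aeval (a : Fin n → ℝ)).toLinearMap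

@[simp]
lemma evalOn_apply (A : Set (Fin n → ℝ)) (p : MvPolynomial (Fin n) ℝ) (a : A) :
    evalOn A p a = eval (a : Fin n → ℝ) p := by
  simp [evalOn, aeval_eq_eval]

lemma evalOn_eq_zero_iff {A : Set (Fin n → ℝ)} {p : MvPolynomial (Fin n) ℝ} :
    evalOn A p = 0 ↔ ∀ a ∈ A, eval a p = 0 := by
  simp [funext_iff]

lemma mem_ESet_iff (hr : IsMonomialOrder n r) {A : Set (Fin n → ℝ)} {e : Fin n →₀ ℕ} :
    ⇑e ∈ ESet r A ↔ evalOn A (monomial e 1) ∉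
      (restrictSupport ℝ {d : Fin n →₀ ℕ | r ⇑d ⇑e ∧ d ≠ e}).map (evalOn A) := by
  classical
  refine not_congr ⟨?_, ?_⟩
  · rintro ⟨p, hp, hl⟩
    rw [isLeadMon_coe_iff] at hl
    have hc : coeff e p ≠ 0 := mem_support_iff.1 hl.1
    refine ⟨monomial e 1 - (coeff e p)⁻¹ • p, ?_, ?_⟩
    · refine (mem_restrictSupport_iff ℝ).2 fun d hd => ?_
      have hd := mem_support_iff.1 hd
      rw [coeff_sub, coeff_smul, smul_eq_mul, coeff_monomial] at hd
      have hne : d ≠ e := by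
        rintro rfl
        simp [hc] at hd
      refine ⟨hl.2 d ?_, hne⟩
      rw [mem_support_iff]
      intro h0
      simp [h0, hne.symm] at hd
    · rw [map_sub, map_smul, evalOn_eq_zero_iff.2 hp, smul_zero, sub_zero]
  · rintro ⟨q, hq, hqe⟩
    have hq : ∀ d ∈ q.support, r ⇑d ⇑e ∧ d ≠ e := fun d hd => (mem_restrictSupport_iff ℝ).1 hq hd
    refine ⟨monomial e 1 - q, evalOn_eq_zero_iff.1 (by rw [map_sub, hqe, sub_self]), ?_⟩
    rw [isLeadMon_coe_iff]
    have hqe : coeff e q = 0 := by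
      by_contra h
      exact (hq e (mem_support_iff.2 h)).2 rfl
    refine ⟨by simp [hqe], fun d hd => ?_⟩
    by_cases hde : d = e
    · exact hde ▸ hr.refl _
    · refine (hq d (mem_support_iff.2 fun h0 => mem_support_iff.1 hd ?_)).1
      rw [coeff_sub, h0, coeff_monomial, if_neg (Ne.symm hde), sub_zero]

lemma evalOn_surjective {A : Set (Fin n → ℝ)} (hA : A.Finite) :
    Function.Surjective (evalOn A) := by
  classical
  have := hA.fintype
  rw [← LinearMap.range_eq_top, eq_top_iff, ← (Pi.basisFun ℝ A).span_eq, Submodule.span_le]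
  rintro _ ⟨a, rfl⟩
  have hsep : ∀ b : A, ∃ p : MvPolynomial (Fin n) ℝ,
      eval (a : Fin n → ℝ) p = 1 ∧ (b ≠ a → eval (b : Fin n → ℝ) p = 0) := fun b => by
    by_cases hb : b = a
    · exact ⟨1, by simp [hb]⟩
    · obtain ⟨i, hi⟩ := Function.ne_iff.1 (Subtype.coe_injective.ne hb)
      refine ⟨C ((a : Fin n → ℝ) i - (b : Fin n → ℝ) i)⁻¹ * (X i - C ((b : Fin n → ℝ) i)), ?_, ?_⟩
      · simpa using inv_mul_cancel₀ (sub_ne_zero.2 (Ne.symm hi))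
      · simp
  choose p hp1 hp0 using hsep
  refine ⟨∏ b, p b, funext fun b => ?_⟩
  rw [evalOn_apply, map_prod, Pi.basisFun_apply]
  by_cases hb : b = a
  · subst hb; simp [hp1]
  · rw [Finset.prod_eq_zero (Finset.mem_univ b) (hp0 b hb), Pi.single_eq_of_ne hb]

lemma ker_evalOn_domRestrict (hr : IsMonomialOrder n r) (A : Set (Fin n → ℝ)) :
    LinearMap.ker ((evalOn A).domRestrict
      (restrictSupport ℝ {d : Fin n →₀ ℕ | ⇑d ∈ ESet r A})) = ⊥ := by
  rw [LinearMap.ker_eq_bot']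
  rintro ⟨p, hp⟩ h0
  by_contra hne
  obtain ⟨e, he, hl⟩ := hr.exists_isLeadMon (p := p) (by simpa [Subtype.ext_iff] using hne)
  exact hp he ⟨p, evalOn_eq_zero_iff.1 h0, hl⟩

lemma map_evalOn_restrictSupport_ESet (hr : IsMonomialOrder n r) (A : Set (Fin n → ℝ)) :
    (restrictSupport ℝ {d : Fin n →₀ ℕ | ⇑d ∈ ESet r A}).map (evalOn A) =
      LinearMap.range (evalOn A) := by
  refine le_antisymm LinearMap.map_le_range ?_
  have key : ∀ f : Fin n → ℕ, evalOn A (monomial (Finsupp.equivFunOnFinite.symm f) 1) ∈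
      (restrictSupport ℝ {d : Fin n →₀ ℕ | ⇑d ∈ ESet r A}).map (evalOn A) := fun f => by
    induction f using hr.wf.induction with
    | _ f ih =>
      set e := Finsupp.equivFunOnFinite.symm f
      have hef : ⇑e = f := rfl
      by_cases he : ⇑e ∈ ESet r A
      · exact Submodule.mem_map_of_mem (by simpa using he)
      · rw [mem_ESet_iff hr, not_not] at he
        refine (?_ : Submodule.map _ _ ≤ _) he
        rw [restrictSupport_eq_span, Submodule.map_span_le]
        rintro _ ⟨d, ⟨hd, hde⟩, rfl⟩
        have := ih d ⟨hd, fun h => hde (DFunLike.coe_injective h)⟩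
        simpa using this
  rw [LinearMap.range_eq_map, ← restrictSupport_univ, restrictSupport_eq_span,
    Submodule.map_span_le]
  rintro _ ⟨d, -, rfl⟩
  simpa using key d

/-- For finite `A`, the set `ESet r A` has as many elements as `A`. -/
lemma ncard_ESet (hr : IsMonomialOrder n r) {A : Set (Fin n → ℝ)} (hA : A.Finite) :
    (ESet r A).Finite ∧ (ESet r A).ncard = A.ncard := by
  have := hA.fintype
  let E : Set (Fin n →₀ ℕ) := {d | ⇑d ∈ ESet r A}
  let T := (evalOn A).domRestrict (restrictSupport ℝ E)
  have hsurj : Function.Surjective T := by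
    rw [← LinearMap.range_eq_top, LinearMap.range_domRestrict,
      map_evalOn_restrictSupport_ESet hr, LinearMap.range_eq_top]
    exact evalOn_surjective hA
  let b : Module.Basis E ℝ (A → ℝ) := (basisRestrictSupport ℝ E).map
    (LinearEquiv.ofBijective T ⟨LinearMap.ker_eq_bot.1 (ker_evalOn_domRestrict hr A), hsurj⟩)
  have hE : (ESet r A) = (fun d : Fin n →₀ ℕ => (⇑d : Fin n → ℕ)) '' E := by
    ext f
    refine ⟨fun hf => ⟨Finsupp.equivFunOnFinite.symm f, by simpa [E] using hf, by simp⟩, ?_⟩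
    rintro ⟨d, hd, rfl⟩
    exact hd
  have hfin : Finite E := Module.Finite.finite_basis b
  refine ⟨hE ▸ (Set.toFinite E).image _, ?_⟩
  rw [hE, Set.ncard_image_of_injective _ DFunLike.coe_injective, ← Nat.card_coe_set_eq,
    ← Module.finrank_eq_nat_card_basis b, Module.finrank_fintype_fun_eq_card,
    ← Nat.card_coe_set_eq, Nat.card_eq_fintype_card]

end Polynomial

section Sumset

variable {n : ℕ} {r : (Fin n → ℕ) → (Fin n → ℕ) → Prop}

/-- A finitely supported signed measure on `A` whose moment at `e` is nonzero while all moments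
at exponents below `e` vanish. -/
lemma exists_moments_of_mem_ESet (hr : IsMonomialOrder n r) {A : Set (Fin n → ℝ)} [Fintype A]
    {e : Fin n →₀ ℕ} (he : ⇑e ∈ ESet r A) :
    ∃ μ : A → ℝ, (∑ a, μ a * eval (a : Fin n → ℝ) (monomial e 1) ≠ 0) ∧
      ∀ d : Fin n →₀ ℕ, ∑ a, μ a * eval (a : Fin n → ℝ) (monomial d 1) ≠ 0 → r ⇑e ⇑d := by
  classical
  rw [mem_ESet_iff hr] at he
  obtain ⟨f, hfe, hf⟩ := Submodule.exists_dual_map_eq_bot_of_notMem he inferInstance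
  have hsum : ∀ p, f (evalOn A p) =
      ∑ a, f (fun j => if a = j then 1 else 0) * eval (a : Fin n → ℝ) p := fun p => by
    rw [LinearMap.pi_apply_eq_sum_univ f]
    simp [mul_comm]
  refine ⟨fun a => f (fun j => if a = j then 1 else 0), by rwa [← hsum], fun d hd => ?_⟩
  rw [← hsum] at hd
  by_contra h
  have hde : r ⇑d ⇑e := (hr.1 _ _).resolve_right h
  refine hd ?_
  rw [← Submodule.mem_bot ℝ, ← hf]
  refine Submodule.mem_map_of_mem (Submodule.mem_map_of_mem ?_)
  rw [monomial_mem_restrictSupport]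
  exact Or.inl ⟨hde, fun hh => h (hh ▸ hr.refl _)⟩

lemma eval_add_monomial (d : Fin n →₀ ℕ) (a b : Fin n → ℝ) :
    eval (a + b) (monomial d (1 : ℝ)) = ∑ c ∈ Finset.Iic d,
      (∏ i, ((d i).choose (c i) : ℝ)) *
        (eval a (monomial c 1) * eval b (monomial (d - c) 1)) := by
  classical
  have hmon : ∀ (c : Fin n →₀ ℕ) (x : Fin n → ℝ),
      eval x (monomial c (1 : ℝ)) = ∏ i, x i ^ c i := fun c x => by
    rw [eval_monomial, one_mul, Finsupp.prod_fintype _ _ fun _ => pow_zero _]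
  simp only [hmon, Pi.add_apply, add_pow, Finset.prod_univ_sum, ← Finset.prod_mul_distrib]
  refine Finset.sum_bij' (fun c _ => Finsupp.equivFunOnFinite.symm c) (fun c _ => ⇑c) ?_ ?_ ?_ ?_ ?_
  · intro c hc
    rw [Finset.mem_Iic]
    intro i
    have := Fintype.mem_piFinset.1 hc i
    simpa [Nat.lt_succ_iff] using this
  · intro c hc
    rw [Fintype.mem_piFinset]
    intro i
    simpa [Nat.lt_succ_iff] using Finset.mem_Iic.1 hc i
  · intros; rfl
  · intros; ext; rfl
  · intro c hc
    refine Finset.prod_congr rfl fun i _ => ?_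
    simp only [Finsupp.equivFunOnFinite_symm_apply_apply, Finsupp.coe_tsub, Pi.sub_apply]
    ring

/-- Exponent sets are superadditive under sumsets. -/
lemma add_mem_ESet (hr : IsMonomialOrder n r) {A B : Set (Fin n → ℝ)} (hA : A.Finite)
    (hB : B.Finite) {e f : Fin n → ℕ} (he : e ∈ ESet r A) (hf : f ∈ ESet r B) :
    e + f ∈ ESet r (A + B) := by
  classical
  have := hA.fintype
  have := hB.fintype
  obtain ⟨e, rfl⟩ : ∃ e' : Fin n →₀ ℕ, ⇑e' = e := ⟨Finsupp.equivFunOnFinite.symm e, rfl⟩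
  obtain ⟨f, rfl⟩ : ∃ f' : Fin n →₀ ℕ, ⇑f' = f := ⟨Finsupp.equivFunOnFinite.symm f, rfl⟩
  obtain ⟨μ, hμe, hμ⟩ := exists_moments_of_mem_ESet hr he
  obtain ⟨ν, hνf, hν⟩ := exists_moments_of_mem_ESet hr hf
  set M : (Fin n →₀ ℕ) → ℝ := fun d => ∑ a, μ a * eval (a : Fin n → ℝ) (monomial d 1) with hM
  set N : (Fin n →₀ ℕ) → ℝ := fun d => ∑ b, ν b * eval (b : Fin n → ℝ) (monomial d 1) with hN
  have hconv : ∀ d : Fin n →₀ ℕ,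
      ∑ a, ∑ b, μ a * ν b * eval (a + b : Fin n → ℝ) (monomial d 1) =
        ∑ c ∈ Finset.Iic d, (∏ i, ((d i).choose (c i) : ℝ)) * (M c * N (d - c)) := fun d => by
    simp only [eval_add_monomial, Finset.mul_sum]
    rw [Finset.sum_congr rfl fun a _ => Finset.sum_comm, Finset.sum_comm]
    refine Finset.sum_congr rfl fun c _ => ?_
    rw [hM, hN, Finset.sum_mul_sum, Finset.mul_sum]
    refine Finset.sum_congr rfl fun a _ => ?_
    rw [Finset.mul_sum]
    exact Finset.sum_congr rfl fun b _ => by ring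
  rintro ⟨p, hp, hl⟩
  rw [← Finsupp.coe_add, isLeadMon_coe_iff] at hl
  have hzero : ∑ a, ∑ b, μ a * ν b * eval (a + b : Fin n → ℝ) p = 0 :=
    Finset.sum_eq_zero fun a _ => Finset.sum_eq_zero fun b _ => by
      rw [hp _ (Set.add_mem_add a.2 b.2), mul_zero]
  have hexp : ∑ a, ∑ b, μ a * ν b * eval (a + b : Fin n → ℝ) p =
      ∑ d ∈ p.support, coeff d p *
        ∑ c ∈ Finset.Iic d, (∏ i, ((d i).choose (c i) : ℝ)) * (M c * N (d - c)) := by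
    have hev : ∀ x : Fin n → ℝ, eval x p =
        ∑ d ∈ p.support, coeff d p * eval x (monomial d 1) := fun x => by
      conv_lhs => rw [p.as_sum, map_sum]
      simp [eval_monomial]
    simp only [← hconv, hev, Finset.mul_sum]
    rw [Finset.sum_comm (s := p.support)]
    refine Finset.sum_congr rfl fun a _ => ?_
    rw [Finset.sum_comm]
    exact Finset.sum_congr rfl fun c _ => Finset.sum_congr rfl fun b _ => by ring
  have hkey : ∀ d ∈ p.support, ∀ c ∈ Finset.Iic d, M c * N (d - c) ≠ 0 → d = e + f ∧ c = e := by
    intro d hd c hc h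
    obtain ⟨h1, h2⟩ := mul_ne_zero_iff.1 h
    have hcd : c + (d - c) = d := add_tsub_cancel_of_le (Finset.mem_Iic.1 hc)
    have hle : r ⇑(c + (d - c)) ⇑(e + f) := hcd.symm ▸ hl.2 d hd
    obtain ⟨h3, h4⟩ := hr.eq_and_eq_of_add_eq (hμ c h1) (hν _ h2) hle
    have h3 : e = c := DFunLike.coe_injective h3
    have h4 : f = d - c := DFunLike.coe_injective h4
    exact ⟨by rw [← hcd, ← h4, h3], h3.symm⟩
  rw [hexp, Finset.sum_eq_single (e + f), Finset.sum_eq_single e] at hzero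
  · rw [add_tsub_cancel_left] at hzero
    refine mul_ne_zero (mem_support_iff.1 hl.1) (mul_ne_zero ?_ (mul_ne_zero hμe hνf)) hzero
    refine Finset.prod_ne_zero_iff.2 fun i _ => ?_
    exact_mod_cast (Nat.choose_pos (by simp)).ne'
  · intro c hc hne
    by_contra h
    exact hne (hkey _ hl.1 c hc (right_ne_zero_of_mul h)).2
  · intro h
    exact absurd (Finset.mem_Iic.2 (by simp)) h
  · intro d hd hne
    refine mul_eq_zero_of_right _ (Finset.sum_eq_zero fun c hc => ?_)
    by_contra h
    exact hne (hkey d hd c hc (right_ne_zero_of_mul h)).1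
  · exact fun h => absurd hl.1 h

end Sumset

section Lattice

variable {n : ℕ}

lemma coe_span_basisFun_eq_latticePoints :
    (Submodule.span ℤ (Set.range (Pi.basisFun ℝ (Fin n))) : Set (Fin n → ℝ)) =
      latticePoints n := by
  ext x
  simp [Module.Basis.mem_span_iff_repr_mem, latticePoints, eq_comm]

/-- The number of points of `P` in ever finer lattices, normalized, tends to the volume. -/
lemma tendsto_ncard_smul_inter_latticePoints {P : Set (Fin n → ℝ)} (hb : Bornology.IsBounded P)
    (hm : MeasurableSet P) (hf : volume (frontier P) = 0) :
    Filter.Tendsto (fun k : ℕ => ((((2 ^ k : ℝ) • P) ∩ latticePoints n).ncard : ENNReal) *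
      ENNReal.ofReal (1 / 2 ^ k) ^ n) Filter.atTop (nhds (volume P)) := by
  have h := ENNReal.tendsto_ofReal ((tendsto_card_div_pow_atTop_volume P hb hm hf).comp
    (tendsto_pow_atTop_atTop_of_one_lt (one_lt_two : (1 : ℕ) < 2)))
  rw [ofReal_measureReal hb.measure_lt_top.ne] at h
  refine h.congr fun k => ?_
  have h2 : (2 ^ k : ℝ) ≠ 0 := by positivity
  have hcard : (((2 ^ k : ℝ) • P) ∩ latticePoints n).ncard =
      Nat.card ↑(P ∩ (2 ^ k : ℝ)⁻¹ • (Submodule.span ℤ (Set.range (Pi.basisFun ℝ (Fin n))) :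
        Set (Fin n → ℝ))) := by
    rw [Nat.card_coe_set_eq, ← Set.ncard_image_of_injective
        (P ∩ (2 ^ k : ℝ)⁻¹ • (Submodule.span ℤ (Set.range (Pi.basisFun ℝ (Fin n))) :
          Set (Fin n → ℝ))) (smul_right_injective _ h2), Set.image_smul, Set.smul_set_inter₀ h2,
      smul_inv_smul₀ h2,
      coe_span_basisFun_eq_latticePoints]
  rw [hcard]
  simp only [Function.comp_apply, Fintype.card_fin, Nat.cast_pow, Nat.cast_ofNat]
  rw [div_eq_mul_one_div, ENNReal.ofReal_mul (Nat.cast_nonneg _), ENNReal.ofReal_natCast,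
    ← one_div_pow, ENNReal.ofReal_pow (by positivity)]

/-- The coordinates of lattice points in `2 ^ k • P` lie in a finite set of size `O(2 ^ k)`. -/
lemma exists_finset_coords {P : Set (Fin n → ℝ)} (hb : Bornology.IsBounded P) :
    ∃ N : ℕ, ∀ k : ℕ, ∃ s : Finset ℝ, s.card ≤ 2 ^ k * N ∧
      ∀ a ∈ ((2 ^ k : ℝ) • P) ∩ latticePoints n, ∀ i, a i ∈ s := by
  classical
  obtain ⟨R, hR⟩ := hb.exists_norm_le
  obtain ⟨N, hN⟩ := exists_nat_ge R
  refine ⟨2 * N + 1, fun k => ⟨(Finset.Icc (-(2 ^ k * N) : ℤ) (2 ^ k * N)).image (↑), ?_, ?_⟩⟩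
  · refine Finset.card_image_le.trans ?_
    rw [Int.card_Icc]
    have : (1 : ℤ) ≤ 2 ^ k := one_le_pow₀ (by norm_num)
    zify
    rw [Int.toNat_of_nonneg (by linarith [show (0 : ℤ) ≤ 2 ^ k * N by positivity])]
    nlinarith
  · rintro a ⟨⟨x, hx, rfl⟩, ha⟩ i
    obtain ⟨m, hm⟩ := ha i
    have hm : 2 ^ k * x i = m := hm
    rw [Finset.mem_image]
    refine ⟨m, ?_, hm.symm⟩
    have h1 : |x i| ≤ N := (norm_le_pi_norm x i).trans ((hR x hx).trans hN)
    have h2 : |(m : ℝ)| ≤ 2 ^ k * N := by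
      rw [← hm, abs_mul, abs_of_pos (by positivity : (0 : ℝ) < 2 ^ k)]
      gcongr
    rw [Finset.mem_Icc, ← abs_le]
    exact_mod_cast h2

lemma finite_smul_inter_latticePoints {P : Set (Fin n → ℝ)} (hb : Bornology.IsBounded P) (k : ℕ) :
    (((2 ^ k : ℝ) • P) ∩ latticePoints n).Finite := by
  obtain ⟨N, hN⟩ := exists_finset_coords hb
  obtain ⟨s, -, hs⟩ := hN k
  exact (Set.Finite.pi' fun _ : Fin n => s.finite_toSet).subset fun a ha i => hs a ha i

/-- Lattice points of dilates of a convex set add up inside the doubled dilate. -/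
lemma smul_inter_latticePoints_add_subset {P : Set (Fin n → ℝ)} (hc : Convex ℝ P) (k : ℕ) :
    (((2 ^ k : ℝ) • P) ∩ latticePoints n) + (((2 ^ k : ℝ) • P) ∩ latticePoints n) ⊆
      ((2 ^ (k + 1) : ℝ) • P) ∩ latticePoints n := by
  rintro _ ⟨a, ⟨ha, ha'⟩, b, ⟨hb, hb'⟩, rfl⟩
  refine ⟨?_, fun i => ?_⟩
  · rw [pow_succ, mul_two, hc.add_smul (by positivity) (by positivity)]
    exact Set.add_mem_add ha hb
  · obtain ⟨p, hp⟩ := ha' i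
    obtain ⟨q, hq⟩ := hb' i
    exact ⟨p + q, by simp [hp, hq]⟩

/-- The half-open cube of side `2⁻ᵏ` with lower corner `2⁻ᵏ e`. -/
def dyadicCube (k : ℕ) (e : Fin n → ℕ) : Set (Fin n → ℝ) :=
  Set.univ.pi fun i => Set.Ico ((e i : ℝ) / 2 ^ k) ((e i + 1) / 2 ^ k)

lemma mem_dyadicCube {k : ℕ} {e : Fin n → ℕ} {x : Fin n → ℝ} :
    x ∈ dyadicCube k e ↔ ∀ i, (e i : ℝ) ≤ x i * 2 ^ k ∧ x i * 2 ^ k < e i + 1 := by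
  have h : (0 : ℝ) < 2 ^ k := by positivity
  simp [dyadicCube, Set.mem_pi, div_le_iff₀ h, lt_div_iff₀ h]

lemma measurableSet_dyadicCube (k : ℕ) (e : Fin n → ℕ) : MeasurableSet (dyadicCube k e) :=
  MeasurableSet.univ_pi fun _ => measurableSet_Ico

lemma volume_dyadicCube (k : ℕ) (e : Fin n → ℕ) :
    volume (dyadicCube k e) = ENNReal.ofReal (1 / 2 ^ k) ^ n := by
  rw [dyadicCube, Real.volume_pi_Ico]
  simp [← sub_div]

lemma pairwise_disjoint_dyadicCube (k : ℕ) :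
    Pairwise (Function.onFun Disjoint (dyadicCube (n := n) k)) := by
  intro e f hne
  rw [Function.onFun, Set.disjoint_left]
  intro x hx hy
  rw [mem_dyadicCube] at hx hy
  refine hne (funext fun i => le_antisymm ?_ ?_)
  · exact Nat.lt_succ_iff.1 (by exact_mod_cast (hx i).1.trans_lt (hy i).2)
  · exact Nat.lt_succ_iff.1 (by exact_mod_cast (hy i).1.trans_lt (hx i).2)

lemma volume_biUnion_dyadicCube (k : ℕ) {E : Set (Fin n → ℕ)} (hE : E.Finite) :
    volume (⋃ e ∈ E, dyadicCube k e) = E.ncard * ENNReal.ofReal (1 / 2 ^ k) ^ n := by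
  lift E to Finset (Fin n → ℕ) using hE
  have := measure_biUnion_finset (μ := volume) (s := E) (f := dyadicCube k)
    (fun _ _ _ _ h => pairwise_disjoint_dyadicCube k h) fun e _ => measurableSet_dyadicCube k e
  simpa [volume_dyadicCube] using this

end Lattice

section Volume

variable {n : ℕ} {r : (Fin n → ℕ) → (Fin n → ℕ) → Prop} {P : Set (Fin n → ℝ)}

lemma SP_mono {Q : Set (Fin n → ℝ)} (h : P ⊆ Q) : SP r P ⊆ SP r Q :=
  closure_mono <| Set.iUnion_mono fun _ => Set.image_mono <|
    ESet_mono <| Set.inter_subset_inter_left _ <| Set.smul_set_mono h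

lemma isCompact_SP (hr : IsMonomialOrder n r) (hb : Bornology.IsBounded P) :
    IsCompact (SP r P) := by
  obtain ⟨N, hN⟩ := exists_finset_coords hb
  refine Metric.isCompact_of_isClosed_isBounded isClosed_closure
    (Bornology.IsBounded.closure ((Metric.isBounded_Icc (0 : Fin n → ℝ) fun _ => N).subset ?_))
  rw [Set.iUnion_subset_iff]
  rintro k _ ⟨e, he, rfl⟩
  obtain ⟨s, hs, hs'⟩ := hN k
  refine ⟨fun i => by positivity, fun i => ?_⟩
  have h1 := (apply_lt_card_of_mem_ESet hr (fun a ha => hs' a ha i) he).le.trans hs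
  show (e i : ℝ) / 2 ^ k ≤ N
  rw [div_le_iff₀ (by positivity), mul_comm]
  exact_mod_cast h1

lemma tendsto_volume_biUnion_dyadicCube (hr : IsMonomialOrder n r) (hb : Bornology.IsBounded P)
    (hm : MeasurableSet P) (hf : volume (frontier P) = 0) :
    Filter.Tendsto (fun k : ℕ =>
      volume (⋃ e ∈ ESet r (((2 ^ k : ℝ) • P) ∩ latticePoints n), dyadicCube k e))
      Filter.atTop (nhds (volume P)) := by
  refine (tendsto_ncard_smul_inter_latticePoints hb hm hf).congr fun k => ?_
  obtain ⟨h1, h2⟩ := ncard_ESet hr (finite_smul_inter_latticePoints hb k)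
  rw [volume_biUnion_dyadicCube k h1, h2]

lemma biUnion_dyadicCube_subset_cthickening (k : ℕ) :
    (⋃ e ∈ ESet r (((2 ^ k : ℝ) • P) ∩ latticePoints n), dyadicCube k e) ⊆
      Metric.cthickening (1 / 2 ^ k) (SP r P) := by
  rw [Set.iUnion₂_subset_iff]
  intro e he x hx
  refine Metric.mem_cthickening_of_dist_le x (fun i => (e i : ℝ) / 2 ^ k) _ _
    (subset_closure (Set.mem_iUnion.2 ⟨k, e, he, rfl⟩)) ?_
  refine (dist_pi_le_iff (by positivity)).2 fun i => ?_
  have h2 : (0 : ℝ) < 2 ^ k := by positivity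
  obtain ⟨h3, h4⟩ := mem_dyadicCube.1 hx i
  rw [← div_le_iff₀ h2] at h3
  rw [← lt_div_iff₀ h2, add_div] at h4
  rw [Real.dist_eq, abs_le]
  constructor <;> linarith [show 0 < 1 / (2 : ℝ) ^ k by positivity]

lemma volume_le_volume_SP (hr : IsMonomialOrder n r) (hb : Bornology.IsBounded P)
    (hm : MeasurableSet P) (hf : volume (frontier P) = 0) : volume P ≤ volume (SP r P) := by
  have hlim : Filter.Tendsto (fun k : ℕ => (1 : ℝ) / 2 ^ k) Filter.atTop (nhds 0) := by
    simpa [← one_div_pow] using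
      tendsto_pow_atTop_nhds_zero_of_lt_one (by norm_num : (0 : ℝ) ≤ 1 / 2) (by norm_num)
  exact le_of_tendsto_of_tendsto' (tendsto_volume_biUnion_dyadicCube hr hb hm hf)
    ((tendsto_measure_cthickening_of_isCompact (isCompact_SP hr hb)).comp hlim)
    fun k => measure_mono (biUnion_dyadicCube_subset_cthickening k)

/-- The down-closure in the nonnegative orthant of the `k`-th approximation to `SP r P`. -/
def dyadicLower (r : (Fin n → ℕ) → (Fin n → ℕ) → Prop) (P : Set (Fin n → ℝ)) (k : ℕ) :
    Set (Fin n → ℝ) :=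
  {x | 0 ≤ x ∧ ∃ e ∈ ESet r (((2 ^ k : ℝ) • P) ∩ latticePoints n), ∀ i, x i * 2 ^ k ≤ e i}

lemma monotone_dyadicLower (hr : IsMonomialOrder n r) (hb : Bornology.IsBounded P)
    (hc : Convex ℝ P) : Monotone (dyadicLower r P) := by
  refine monotone_nat_of_le_succ fun k => ?_
  rintro x ⟨hx, e, he, hxe⟩
  have hfin := finite_smul_inter_latticePoints hb k
  refine ⟨hx, e + e, ESet_mono (smul_inter_latticePoints_add_subset hc k)
    (add_mem_ESet hr hfin hfin he he), fun i => ?_⟩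
  have := hxe i
  rw [pow_succ, Pi.add_apply]
  push_cast
  linarith

lemma dyadicLower_subset_biUnion_dyadicCube (hr : IsMonomialOrder n r) (k : ℕ) :
    dyadicLower r P k ⊆
      ⋃ e ∈ ESet r (((2 ^ k : ℝ) • P) ∩ latticePoints n), dyadicCube k e := by
  rintro x ⟨hx, e, he, hxe⟩
  refine Set.mem_iUnion₂.2 ⟨fun i => ⌊x i * 2 ^ k⌋₊,
    isLowerSet_ESet hr _ (fun i => Nat.floor_le_of_le (hxe i)) he, ?_⟩
  exact mem_dyadicCube.2 fun i =>
    ⟨Nat.floor_le (mul_nonneg (hx i) (by positivity)), Nat.lt_floor_add_one _⟩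

lemma volume_SP_le_iUnion_dyadicLower :
    volume (SP r P) ≤ volume (⋃ k, dyadicLower r P k) := by
  let U : Set (Fin n → ℝ) := ⋃ k : ℕ, (fun (e : Fin n → ℕ) (i : Fin n) => (e i : ℝ) / 2 ^ k) ''
    ESet r (((2 ^ k : ℝ) • P) ∩ latticePoints n)
  let L : Set (Fin n → ℝ) := lowerClosure U
  have hU : U ⊆ Set.Ici 0 := by
    refine Set.iUnion_subset fun k => ?_
    rintro _ ⟨e, -, rfl⟩ i
    positivity
  have hL : L ∩ Set.Ici 0 ⊆ ⋃ k, dyadicLower r P k := by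
    rintro x ⟨⟨u, hu, hxu⟩, hx⟩
    obtain ⟨k, e, he, rfl⟩ := Set.mem_iUnion.1 hu
    exact Set.mem_iUnion.2 ⟨k, hx, e, he, fun i => (le_div_iff₀ (by positivity)).1 (hxu i)⟩
  have hsub : SP r P ⊆ (⋃ k, dyadicLower r P k) ∪ frontier L := by
    intro x hx
    by_cases hxL : x ∈ L
    · exact Or.inl (hL ⟨hxL, closure_minimal hU isClosed_Ici hx⟩)
    · exact Or.inr ⟨closure_mono subset_lowerClosure hx, fun h => hxL (interior_subset h)⟩
  calc volume (SP r P) ≤ volume (⋃ k, dyadicLower r P k) + volume (frontier L) :=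
        (measure_mono hsub).trans (measure_union_le _ _)
    _ = volume (⋃ k, dyadicLower r P k) := by
        rw [(lowerClosure U).lower.null_frontier, add_zero]

lemma volume_SP_le_volume (hr : IsMonomialOrder n r) (hb : Bornology.IsBounded P)
    (hc : Convex ℝ P) (hm : MeasurableSet P) (hf : volume (frontier P) = 0) :
    volume (SP r P) ≤ volume P := by
  have hmono := monotone_dyadicLower hr hb hc
  refine volume_SP_le_iUnion_dyadicLower.trans ?_
  rw [hmono.measure_iUnion]
  refine iSup_le fun k => ge_of_tendsto (tendsto_volume_biUnion_dyadicCube hr hb hm hf) ?_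
  filter_upwards [Filter.eventually_ge_atTop k] with j hj
  exact measure_mono ((hmono hj).trans (dyadicLower_subset_biUnion_dyadicCube hr j))

lemma volume_SP_of_measurableSet (hr : IsMonomialOrder n r) (hb : Bornology.IsBounded P)
    (hc : Convex ℝ P) (hm : MeasurableSet P) : volume (SP r P) = volume P :=
  (volume_SP_le_volume hr hb hc hm (hc.addHaar_frontier _)).antisymm
    (volume_le_volume_SP hr hb hm (hc.addHaar_frontier _))

end Volume

/-- For a bounded convex set `P ⊆ ℝⁿ` of positive Lebesgue measure,
`S_P` has the same Lebesgue measure as `P`. -/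
theorem volume_SP {n : ℕ}
    (r : (Fin n → ℕ) → (Fin n → ℕ) → Prop) (hr : IsMonomialOrder n r)
    (P : Set (Fin n → ℝ)) (hb : Bornology.IsBounded P) (hc : Convex ℝ P)
    (hv : 0 < volume P) :
    volume (SP r P) = volume P := by
  have hf := hc.addHaar_frontier volume
  apply le_antisymm
  · calc volume (SP r P) ≤ volume (SP r (closure P)) := measure_mono (SP_mono subset_closure)
      _ = volume (closure P) :=
        volume_SP_of_measurableSet hr hb.closure hc.closure isClosed_closure.measurableSet
      _ = volume P := measure_closure_of_null_frontier hf
  · calc volume P = volume (interior P) := (measure_interior_of_null_frontier hf).symm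
      _ = volume (SP r (interior P)) := (volume_SP_of_measurableSet hr
        (hb.subset interior_subset) hc.interior isOpen_interior.measurableSet).symm
      _ ≤ volume (SP r P) := measure_mono (SP_mono interior_subset)
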